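/- Let (Ω, 𝓕, ℙ) be a probability space, T > 0, κ ≥ 2, Δ ∈ (0, T], and B, C₀ > 0. Let b̄: ℝⁿ × 𝒫_κ(ℝⁿ) → ℝⁿ be measurable and satisfy the growth bound |b̄(x,μ)| ≤ C₀ (1 + M_κ(μ)^{1/2}) |x| + C₀ (1 + |x|^{κ/2} + M_κ(μ)^{1/2})(1 + M_κ(μ)^{1/2}) M₂(μ)^{1/2} for all x ∈ ℝⁿ and μ ∈ 𝒫_κ(ℝⁿ). Let X̄: Ω × [0,T] → ℝⁿ be a measurable process whose paths are absolutely continuous with dX̄_t/dt = b̄(X̄_t, 𝓛_{X̄_t}) for almost every t ∈ [0,T], and assume E[sup_{t∈[0,T]} |X̄_t|^κ] ≤ B. Then sup_{t∈[0,T]} E|X̄_t − X̄_{t(Δ)}|² ≤ C Δ², where t(Δ) := ⌊t/Δ⌋Δ and C depends only on κ, T, C₀ and B. -/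

import Mathlib

open MeasureTheory

noncomputable section

/-- `ℝ^n` with the Euclidean norm. -/
abbrev Euc (n : ℕ) : Type := EuclideanSpace ℝ (Fin n)

theorem self_le_one_add_rpow {x p : ℝ} (hx : 0 ≤ x) (hp : 1 ≤ p) : x ≤ 1 + x ^ p := by
  rcases le_total x 1 with h | h
  · linarith [Real.rpow_nonneg hx p]
  · linarith [Real.self_le_rpow_of_one_le h hp]

theorem rpow_half_sq {x p : ℝ} (hx : 0 ≤ x) : (x ^ (p / 2)) ^ 2 = x ^ p := by
  rw [← Real.rpow_natCast, ← Real.rpow_mul hx]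
  congr 1
  push_cast
  ring

theorem sq_le_one_add_rpow {x p : ℝ} (hx : 0 ≤ x) (hp : 2 ≤ p) : x ^ 2 ≤ 1 + x ^ p := by
  have h := self_le_one_add_rpow (sq_nonneg x) (p := p / 2) (by linarith)
  rwa [← Real.rpow_natCast_mul hx, show ((2 : ℕ) : ℝ) * (p / 2) = p by push_cast; ring] at h

theorem integral_norm_sq_le {E : Type*} [NormedAddCommGroup E] [MeasurableSpace E]
    {μ : Measure E} [IsProbabilityMeasure μ] {p B : ℝ} (hp : 2 ≤ p)
    (hint : Integrable (fun z => ‖z‖ ^ p) μ) (hB : (∫ z, ‖z‖ ^ p ∂μ) ≤ B) :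
    (∫ z, ‖z‖ ^ 2 ∂μ) ≤ 1 + B := by
  calc (∫ z, ‖z‖ ^ 2 ∂μ) ≤ ∫ z, (1 + ‖z‖ ^ p) ∂μ :=
        integral_mono_of_nonneg (.of_forall fun z => sq_nonneg _)
          ((integrable_const 1).add hint)
          (.of_forall fun z => sq_le_one_add_rpow (norm_nonneg z) hp)
    _ = 1 + ∫ z, ‖z‖ ^ p ∂μ := by
        rw [integral_add (integrable_const 1) hint]
        simp
    _ ≤ 1 + B := by linarith

/-- If `X` is dominated by `S` with `E[S ^ p] ≤ B`, then the law of `X` has `p`-th moment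
at most `B`. -/
theorem map_moment_le {Ω E : Type*} [MeasurableSpace Ω] {P : Measure Ω}
    [NormedAddCommGroup E] [MeasurableSpace E] [BorelSpace E] [SecondCountableTopology E]
    {X : Ω → E} {S : Ω → ℝ} {p B : ℝ} (hp : 0 ≤ p)
    (hX : Measurable X) (hXS : ∀ ω, ‖X ω‖ ≤ S ω) (hS : Integrable (fun ω => S ω ^ p) P)
    (hB : (∫ ω, S ω ^ p ∂P) ≤ B) :
    Integrable (fun z => ‖z‖ ^ p) (P.map X) ∧ (∫ z, ‖z‖ ^ p ∂(P.map X)) ≤ B := by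
  have hm : Measurable fun z : E => ‖z‖ ^ p := measurable_norm.pow_const p
  have hle : ∀ ω, ‖X ω‖ ^ p ≤ S ω ^ p := fun ω =>
    Real.rpow_le_rpow (norm_nonneg _) (hXS ω) hp
  constructor
  · rw [integrable_map_measure hm.aestronglyMeasurable hX.aemeasurable]
    refine hS.mono' (hm.comp hX).aestronglyMeasurable (.of_forall fun ω => ?_)
    simp only [Function.comp_apply]
    rw [Real.norm_of_nonneg (Real.rpow_nonneg (norm_nonneg _) _)]
    exact hle ω
  · rw [integral_map hX.aemeasurable hm.aestronglyMeasurable]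
    exact (integral_mono_of_nonneg
      (.of_forall fun ω => Real.rpow_nonneg (norm_nonneg _) _) hS (.of_forall hle)).trans hB

/-- A path with integrable derivative on `[0, T]` is bounded by its supremum. -/
theorem norm_le_iSup_of_eq_primitive {E : Type*} [NormedAddCommGroup E] [NormedSpace ℝ E]
    {T : ℝ} {x f : ℝ → E} {c : E}
    (hf : IntervalIntegrable f volume 0 T)
    (hx : ∀ t ∈ Set.Icc (0 : ℝ) T, x t = c + ∫ s in (0 : ℝ)..t, f s)
    {t : ℝ} (ht : t ∈ Set.Icc (0 : ℝ) T) :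
    ‖x t‖ ≤ ⨆ s : Set.Icc (0 : ℝ) T, ‖x s.1‖ := by
  have hT : 0 ≤ T := ht.1.trans ht.2
  have hc : ContinuousOn x (Set.Icc 0 T) := by
    have h := intervalIntegral.continuousOn_primitive_interval' hf Set.left_mem_uIcc
    rw [Set.uIcc_of_le hT] at h
    exact (continuousOn_const.add h).congr hx
  have hb : BddAbove (Set.range fun s : Set.Icc (0 : ℝ) T => ‖x s.1‖) := by
    have h := (isCompact_Icc.image_of_continuousOn hc.norm).bddAbove
    rwa [Set.image_eq_range] at h
  exact le_ciSup hb ⟨t, ht⟩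

theorem norm_sub_le_of_eq_primitive {E : Type*} [NormedAddCommGroup E] [NormedSpace ℝ E]
    {T K : ℝ} {x f : ℝ → E} {c : E}
    (hf : IntervalIntegrable f volume 0 T)
    (hx : ∀ t ∈ Set.Icc (0 : ℝ) T, x t = c + ∫ s in (0 : ℝ)..t, f s)
    (hK : ∀ t ∈ Set.Icc (0 : ℝ) T, ‖f t‖ ≤ K)
    {r t : ℝ} (hr : r ∈ Set.Icc (0 : ℝ) T) (ht : t ∈ Set.Icc (0 : ℝ) T) :
    ‖x t - x r‖ ≤ K * |t - r| := by
  have hi : ∀ u ∈ Set.Icc (0 : ℝ) T, IntervalIntegrable f volume 0 u := fun u hu =>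
    hf.mono_set (Set.uIcc_subset_uIcc Set.left_mem_uIcc (Set.Icc_subset_uIcc hu))
  rw [hx t ht, hx r hr, add_sub_add_left_eq_sub,
    intervalIntegral.integral_interval_sub_left (hi t ht) (hi r hr)]
  exact intervalIntegral.norm_integral_le_of_norm_le_const fun s hs =>
    hK s (Set.ordConnected_Icc.uIcc_subset hr ht (Set.uIoc_subset_uIcc hs))

theorem growth_bound_le {C0 m q x S b r κ : ℝ} (hκ : 2 ≤ κ) (hC0 : 0 ≤ C0)
    (hm : 0 ≤ m) (hmb : m ≤ b) (hq : 0 ≤ q) (hqr : q ≤ r) (hx : 0 ≤ x) (hxS : x ≤ S) :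
    C0 * (1 + m) * x + C0 * (1 + x ^ (κ / 2) + m) * (1 + m) * q ≤
      (C0 * (1 + b) + C0 * (1 + b) ^ 2 * r) * (1 + S ^ (κ / 2)) := by
  have hb : 0 ≤ b := hm.trans hmb
  have hr : 0 ≤ r := hq.trans hqr
  have hy : 0 ≤ S ^ (κ / 2) := Real.rpow_nonneg (hx.trans hxS) _
  have hxy : x ≤ 1 + S ^ (κ / 2) :=
    hxS.trans (self_le_one_add_rpow (hx.trans hxS) (by linarith))
  have hpow : x ^ (κ / 2) ≤ S ^ (κ / 2) := Real.rpow_le_rpow hx hxS (by linarith)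
  have hx0 : 0 ≤ x ^ (κ / 2) := Real.rpow_nonneg hx _
  have hmid : 1 + x ^ (κ / 2) + m ≤ (1 + b) * (1 + S ^ (κ / 2)) := by
    nlinarith [mul_nonneg hb hy]
  calc C0 * (1 + m) * x + C0 * (1 + x ^ (κ / 2) + m) * (1 + m) * q
      ≤ C0 * (1 + b) * (1 + S ^ (κ / 2)) +
          C0 * ((1 + b) * (1 + S ^ (κ / 2))) * (1 + b) * r := by gcongr
    _ = _ := by ring

theorem floor_div_mul_mem_Icc {t Δ T : ℝ} (hΔ : 0 < Δ) (ht : t ∈ Set.Icc (0 : ℝ) T) :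
    (⌊t / Δ⌋ : ℝ) * Δ ∈ Set.Icc (0 : ℝ) T := by
  refine ⟨mul_nonneg ?_ hΔ.le, ?_⟩
  · exact_mod_cast Int.floor_nonneg.2 (div_nonneg ht.1 hΔ.le)
  · exact ((le_div_iff₀ hΔ).1 (Int.floor_le _)).trans ht.2

theorem abs_sub_floor_div_mul_le {t Δ : ℝ} (hΔ : 0 < Δ) :
    |t - (⌊t / Δ⌋ : ℝ) * Δ| ≤ Δ := by
  have h1 := (le_div_iff₀ hΔ).1 (Int.floor_le (t / Δ))
  have h2 := (div_lt_iff₀ hΔ).1 (Int.lt_floor_add_one (t / Δ))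
  rw [abs_of_nonneg (by linarith)]
  linarith

/-- time-discretization estimate for the averaged McKean--Vlasov ODE
`dX̄_t/dt = b̄(X̄_t, 𝓛_{X̄_t})` under the growth bound on `b̄` and the κ-th sup-moment
bound `E[sup_{t∈[0,T]} |X̄_t|^κ] ≤ B`:
`sup_{t∈[0,T]} E|X̄_t − X̄_{t(Δ)}|² ≤ C Δ²` with `t(Δ) = ⌊t/Δ⌋Δ` and `C = C(κ, T, C₀, B)`. -/
theorem averaged_equation_time_discretization (n : ℕ) (κ T C0 B : ℝ) (hκ : 2 ≤ κ)
    (hT : 0 < T) (hC0 : 0 < C0) (hB : 0 < B) :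
    ∃ C > 0, ∀ Δ : ℝ, 0 < Δ → Δ ≤ T →
      ∀ (Ω : Type) [MeasurableSpace Ω] (P : Measure Ω), IsProbabilityMeasure P →
      ∀ bbar : Euc n → Measure (Euc n) → Euc n,
        (∀ (x : Euc n) (μ : Measure (Euc n)), IsProbabilityMeasure μ →
          Integrable (fun z => ‖z‖ ^ κ) μ →
          ‖bbar x μ‖ ≤ C0 * (1 + (∫ z, ‖z‖ ^ κ ∂μ) ^ (1 / 2 : ℝ)) * ‖x‖ +
            C0 * (1 + ‖x‖ ^ (κ / 2) + (∫ z, ‖z‖ ^ κ ∂μ) ^ (1 / 2 : ℝ)) *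
              (1 + (∫ z, ‖z‖ ^ κ ∂μ) ^ (1 / 2 : ℝ)) * (∫ z, ‖z‖ ^ 2 ∂μ) ^ (1 / 2 : ℝ)) →
      ∀ X : Ω → ℝ → Euc n,
        (∀ t, Measurable fun ω => X ω t) →
        (∀ ω, IntervalIntegrable
          (fun s => bbar (X ω s) (P.map fun ω' => X ω' s)) volume 0 T) →
        (∀ ω, ∀ t ∈ Set.Icc (0 : ℝ) T,
          X ω t = X ω 0 + ∫ s in (0 : ℝ)..t, bbar (X ω s) (P.map fun ω' => X ω' s)) →
        Integrable (fun ω => (⨆ t : Set.Icc (0 : ℝ) T, ‖X ω t.1‖) ^ κ) P →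
        (∫ ω, (⨆ t : Set.Icc (0 : ℝ) T, ‖X ω t.1‖) ^ κ ∂P) ≤ B →
        ∀ t ∈ Set.Icc (0 : ℝ) T,
          (∫ ω, ‖X ω t - X ω ((⌊t / Δ⌋ : ℝ) * Δ)‖ ^ 2 ∂P) ≤ C * Δ ^ 2 := by
  set b : ℝ := B ^ (1 / 2 : ℝ)
  set r : ℝ := (1 + B) ^ (1 / 2 : ℝ)
  have hb : 0 < b := Real.rpow_pos_of_pos hB _
  have hr : 0 < r := Real.rpow_pos_of_pos (by linarith) _
  set K : ℝ := C0 * (1 + b) + C0 * (1 + b) ^ 2 * r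
  have hK : 0 < K := by positivity
  refine ⟨2 * K ^ 2 * (1 + B), by positivity, ?_⟩
  intro Δ hΔ _ Ω _ P hP bbar hbbar X hXm hint hXeq hSint hSB t ht
  set S : Ω → ℝ := fun ω => ⨆ t : Set.Icc (0 : ℝ) T, ‖X ω t.1‖
  have hXS : ∀ s ∈ Set.Icc (0 : ℝ) T, ∀ ω, ‖X ω s‖ ≤ S ω := fun s hs ω =>
    norm_le_iSup_of_eq_primitive (hint ω) (hXeq ω) hs
  have hS0 : ∀ ω, 0 ≤ S ω := fun ω => (norm_nonneg _).trans (hXS t ht ω)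
  have hdrift : ∀ ω, ∀ s ∈ Set.Icc (0 : ℝ) T,
      ‖bbar (X ω s) (P.map fun ω' => X ω' s)‖ ≤ K * (1 + S ω ^ (κ / 2)) := by
    intro ω s hs
    have hprob : IsProbabilityMeasure (P.map fun ω' => X ω' s) :=
      Measure.isProbabilityMeasure_map (hXm s).aemeasurable
    obtain ⟨hi, hle⟩ := map_moment_le (by linarith) (hXm s) (hXS s hs) hSint hSB
    have h0 : 0 ≤ ∫ z, ‖z‖ ^ κ ∂(P.map fun ω' => X ω' s) :=
      integral_nonneg fun z => Real.rpow_nonneg (norm_nonneg z) _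
    have h2 : 0 ≤ ∫ z, ‖z‖ ^ 2 ∂(P.map fun ω' => X ω' s) :=
      integral_nonneg fun z => sq_nonneg _
    exact (hbbar _ _ hprob hi).trans <| growth_bound_le hκ hC0.le
      (Real.rpow_nonneg h0 _) (Real.rpow_le_rpow h0 hle (by norm_num))
      (Real.rpow_nonneg h2 _)
      (Real.rpow_le_rpow h2 (integral_norm_sq_le hκ hi hle) (by norm_num))
      (norm_nonneg _) (hXS s hs ω)
  have hpt : ∀ ω, ‖X ω t - X ω ((⌊t / Δ⌋ : ℝ) * Δ)‖ ^ 2 ≤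
      2 * K ^ 2 * Δ ^ 2 * (1 + S ω ^ κ) := by
    intro ω
    have hy : 0 ≤ S ω ^ (κ / 2) := Real.rpow_nonneg (hS0 ω) _
    have hd : ‖X ω t - X ω ((⌊t / Δ⌋ : ℝ) * Δ)‖ ≤ K * (1 + S ω ^ (κ / 2)) * Δ :=
      (norm_sub_le_of_eq_primitive (hint ω) (hXeq ω) (hdrift ω)
        (floor_div_mul_mem_Icc hΔ ht) ht).trans <|
        mul_le_mul_of_nonneg_left (abs_sub_floor_div_mul_le hΔ) (by positivity)
    calc ‖X ω t - X ω ((⌊t / Δ⌋ : ℝ) * Δ)‖ ^ 2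
        ≤ (K * (1 + S ω ^ (κ / 2)) * Δ) ^ 2 := by gcongr
      _ = K ^ 2 * Δ ^ 2 * (1 + S ω ^ (κ / 2)) ^ 2 := by ring
      _ ≤ K ^ 2 * Δ ^ 2 * (2 * (1 ^ 2 + (S ω ^ (κ / 2)) ^ 2)) := by
          gcongr
          exact add_sq_le
      _ = 2 * K ^ 2 * Δ ^ 2 * (1 + S ω ^ κ) := by
          rw [rpow_half_sq (hS0 ω)]
          ring
  calc (∫ ω, ‖X ω t - X ω ((⌊t / Δ⌋ : ℝ) * Δ)‖ ^ 2 ∂P)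
      ≤ ∫ ω, 2 * K ^ 2 * Δ ^ 2 * (1 + S ω ^ κ) ∂P :=
        integral_mono_of_nonneg (.of_forall fun ω => sq_nonneg _)
          (((integrable_const 1).add hSint).const_mul _) (.of_forall hpt)
    _ = 2 * K ^ 2 * Δ ^ 2 * (1 + ∫ ω, S ω ^ κ ∂P) := by
        rw [integral_const_mul, integral_add (integrable_const 1) hSint,
          integral_const, probReal_univ, one_smul]
    _ ≤ 2 * K ^ 2 * Δ ^ 2 * (1 + B) := by gcongr
    _ = 2 * K ^ 2 * (1 + B) * Δ ^ 2 := by ring
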